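/- arXiv:2012.08102 — 5 statements merged into one kernel-verified Lean document; each statement's English description precedes it below -/
import Mathlib

section
/- Let v ≤ w in I(r,n) (entrywise) and set μ = λ(w), λ = λ(v). Then no partition μ^{(i)}, for i a corner index of μ, is contained in λ if and only if for every i ∈ {1,...,r−1}: w_{i+1} > w_i + 1 implies v_{i+1} > w_i. (This is the combinatorial content of the paper's Proposition 'semi-singular': for a Schubert variety X_{P_r}(w) in the Grassmannian Gr(r,n) containing the unique minimal Schubert variety X_{P_r}(v) admitting torus-semistable points, the semistable locus is contained in the smooth locus exactly when w_i < v_{i+1} whenever w_{i+1} > w_i + 1.) -/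
/-- The set `I(r,n)` of strictly increasing `r`-tuples with entries in `{1,...,n}`. -/
def Iset (r n : ℕ) : Set (Fin r → ℕ) :=
  {w | StrictMono w ∧ ∀ j, w j ∈ Set.Icc 1 n}

/-- The partition associated to `w ∈ I(r,n)`: `λ(w)_j = n - r + j - w_j` (1-indexed `j`). -/
def lam (n r : ℕ) (w : Fin r → ℕ) : Fin r → ℕ :=
  fun j => n - r + ((j : ℕ) + 1) - w j

/-- `μ^{(i)}`: the partition obtained from `μ` by adding the cell in row `i+1`,
column `μ_i + 1`, and completing to a partition in the minimal way.
Here `i : Fin r` is the 0-indexed corner index (paper's `i` is `i.val + 1`). -/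
def addCell (r : ℕ) (μ : Fin r → ℕ) (i : Fin r) : Fin r → ℕ :=
  fun k => if (k : ℕ) ≤ (i : ℕ) + 1 then max (μ k) (μ i + 1) else μ k

theorem gap_aux {r : ℕ} {w : Fin r → ℕ} (hw : StrictMono w) (d : ℕ) :
    ∀ (k : ℕ) (h : k + d < r), w ⟨k, by omega⟩ + d ≤ w ⟨k + d, h⟩ := by
  induction d with
  | zero => intro k h; simp
  | succ d ih =>
    intro k h
    have h1 := ih k (by omega)
    have h2 : w ⟨k + d, by omega⟩ < w ⟨k + (d + 1), h⟩ := hw (by simp [Fin.lt_def])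
    omega

theorem gap {r : ℕ} {w : Fin r → ℕ} (hw : StrictMono w) (k l : Fin r) (h : (k : ℕ) ≤ l) :
    w k + l ≤ w l + k := by
  obtain ⟨k, hk⟩ := k
  obtain ⟨l, hl⟩ := l
  obtain ⟨d, rfl⟩ := Nat.exists_eq_add_of_le h
  have := gap_aux hw d k hl
  simp only
  omega

theorem Iset_lower {n r : ℕ} {w : Fin r → ℕ} (hw : w ∈ Iset r n) (j : Fin r) :
    (j : ℕ) + 1 ≤ w j := by
  have h0 : 0 < r := by have := j.2; omega
  have h1 := gap hw.1 ⟨0, h0⟩ j (by simp)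
  have h2 := (hw.2 ⟨0, h0⟩).1
  simp only at h1
  omega

theorem Iset_upper {n r : ℕ} {w : Fin r → ℕ} (hw : w ∈ Iset r n) (j : Fin r) :
    w j + r ≤ n + (j + 1) := by
  have h0 : 0 < r := by have := j.2; omega
  have h1 := gap hw.1 j ⟨r - 1, by omega⟩ (by have := j.2; simp only; omega)
  have h2 := (hw.2 ⟨r - 1, by omega⟩).2
  simp only at h1
  omega

theorem stmt3 (n r : ℕ) (hr : 0 < r) (hrn : r < n)
    (v w : Fin r → ℕ) (hv : v ∈ Iset r n) (hw : w ∈ Iset r n)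
    (hvw : ∀ j, v j ≤ w j) :
    (∀ i : Fin r, ∀ hi : (i : ℕ) + 1 < r,
        (lam n r w ⟨(i : ℕ) + 1, hi⟩ < lam n r w i ∧ lam n r w i < n - r) →
        ¬ (∀ j, addCell r (lam n r w) i j ≤ lam n r v j)) ↔
    (∀ i : Fin r, ∀ hi : (i : ℕ) + 1 < r,
        w ⟨(i : ℕ) + 1, hi⟩ > w i + 1 → v ⟨(i : ℕ) + 1, hi⟩ > w i) := by
  constructor
  · intro H i hi hgap
    by_contra hlt
    have lw := Iset_lower hv ⟨(i : ℕ) + 1, hi⟩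
    have u1 := Iset_upper hw i
    have u2 := Iset_upper hw ⟨(i : ℕ) + 1, hi⟩
    simp only at lw u2
    refine H i hi ⟨?_, ?_⟩ ?_
    · simp only [lam]; omega
    · simp only [lam]; omega
    · intro j
      have hj := hvw j
      simp only [addCell, lam]
      split_ifs with hc
      · have g := gap hv.1 j ⟨(i : ℕ) + 1, hi⟩ hc
        simp only at g
        apply max_le <;> omega
      · omega
  · rintro H i hi ⟨h1, h2⟩ hall
    have u1 := Iset_upper hw i
    have u2 := Iset_upper hw ⟨(i : ℕ) + 1, hi⟩
    have u3 := Iset_upper hv ⟨(i : ℕ) + 1, hi⟩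
    simp only at u2 u3
    simp only [lam] at h1 h2
    have hv1 := H i hi (by omega)
    have h3 := hall ⟨(i : ℕ) + 1, hi⟩
    simp only [addCell, lam, le_refl, if_true] at h3
    have h4 := (le_max_right _ _).trans h3
    omega
end

section
/- For n ≥ 4 and 1 ≤ i ≤ n−2, an integer l ∈ {1,...,n} is v_{0,i}-admissible if and only if l = i+2. (Equivalently, the space of torus-invariant sections H^0(X(v_{0,i}), L_{α_0})^T is one-dimensional, spanned by the standard monomial p_{i+2}·p_{1,...,i+1,i+3,...,n}.) -/
/-- `f` is (the one-line function of) a permutation of `{1,...,n}`. -/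
def IsPermOn (n : ℕ) (f : ℕ → ℕ) : Prop :=
  Set.BijOn f (Set.Icc 1 n) (Set.Icc 1 n)

/-- `π_k(f)`: the increasing rearrangement of `(f 1, ..., f k)`, as a list. -/
def piSort (f : ℕ → ℕ) (k : ℕ) : List ℕ :=
  ((List.range' 1 k).map f).insertionSort (· ≤ ·)

/-- The Ehresmann (tableau) order: `u ⪯ w` iff `π_k(u) ≤ π_k(w)` entrywise for all `k`. -/
def Ehr (n : ℕ) (u w : ℕ → ℕ) : Prop :=
  ∀ k, 1 ≤ k → k ≤ n → List.Forall₂ (· ≤ ·) (piSort u k) (piSort w k)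

/-- `l` is `w`-admissible: there are permutations `χ ⪯ φ ⪯ w` with `φ(1) = l = χ(n)`. -/
def Admissible (n : ℕ) (w : ℕ → ℕ) (l : ℕ) : Prop :=
  ∃ φ χ : ℕ → ℕ, IsPermOn n φ ∧ IsPermOn n χ ∧
    Ehr n χ φ ∧ Ehr n φ w ∧ φ 1 = l ∧ χ n = l

/-- The minimal element `v_{0,i}` of `S_n`, with one-line notation
`(i+2, 1, 2, ..., i, i+3, i+4, ..., n, i+1)`. -/
def v0 (n i : ℕ) : ℕ → ℕ := fun k =>
  if k = 1 then i + 2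
  else if k ≤ i + 1 then k - 1
  else if k ≤ n - 1 then k + 1
  else if k = n then i + 1
  else k

lemma piSort_congr (f g : ℕ → ℕ) (k : ℕ) (hf : Set.InjOn f (Set.Icc 1 k))
    (hg : Set.InjOn g (Set.Icc 1 k)) (h : Set.image f (Set.Icc 1 k) = Set.image g (Set.Icc 1 k)) :
    piSort f k = piSort g k := by
  unfold piSort
  have hp : ((List.range' 1 k).map f).Perm ((List.range' 1 k).map g) := by
    rw [List.perm_ext_iff_of_nodup]
    · intro a
      have := Set.ext_iff.1 h a
      simp only [Set.mem_image, Set.mem_Icc] at this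
      simp only [List.mem_map, List.mem_range'_1]
      constructor
      · rintro ⟨x, hx, rfl⟩
        obtain ⟨y, hy, e⟩ := this.1 ⟨x, by omega, rfl⟩
        exact ⟨y, by omega, e⟩
      · rintro ⟨x, hx, rfl⟩
        obtain ⟨y, hy, e⟩ := this.2 ⟨x, by omega, rfl⟩
        exact ⟨y, by omega, e⟩
    · refine List.Nodup.map_on ?_ List.nodup_range'
      intro x hx y hy e
      rw [List.mem_range'_1] at hx hy
      exact hf ⟨by omega, by omega⟩ ⟨by omega, by omega⟩ e
    · refine List.Nodup.map_on ?_ List.nodup_range'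
      intro x hx y hy e
      rw [List.mem_range'_1] at hx hy
      exact hg ⟨by omega, by omega⟩ ⟨by omega, by omega⟩ e
  refine List.Perm.eq_of_pairwise' (r := (· ≤ ·)) (List.pairwise_insertionSort _ _) (List.pairwise_insertionSort _ _) ?_
  exact ((List.perm_insertionSort _ _).trans hp).trans (List.perm_insertionSort _ _).symm

lemma piSort_mono (f : ℕ → ℕ) (k : ℕ) (hf : MonotoneOn f (Set.Icc 1 k)) :
    piSort f k = (List.range' 1 k).map f := by
  unfold piSort
  refine List.Pairwise.insertionSort_eq ?_
  rw [List.pairwise_map]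
  refine List.Pairwise.imp_of_mem ?_ (List.pairwise_lt_range' (s := 1) (n := k))
  intro a b ha hb hab
  rw [List.mem_range'_1] at ha hb
  exact hf ⟨by omega, by omega⟩ ⟨by omega, by omega⟩ hab.le

lemma piSort_sum (f : ℕ → ℕ) (k : ℕ) :
    (piSort f k).sum = ∑ j ∈ Finset.Icc 1 k, f j := by
  unfold piSort
  rw [(List.perm_insertionSort _ _).sum_eq]
  induction k with
  | zero => simp
  | succ k ih =>
    rw [Finset.sum_Icc_succ_top (by omega), ← ih, List.range'_concat]
    simp [add_comm]

lemma perm_sum (n : ℕ) (f : ℕ → ℕ) (hf : IsPermOn n f) :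
    ∑ j ∈ Finset.Icc 1 n, f j = ∑ j ∈ Finset.Icc 1 n, j := by
  refine Finset.sum_bij (fun a _ => f a) ?_ ?_ ?_ ?_
  · intro a ha
    have := hf.1 (by simpa using ha : a ∈ Set.Icc 1 n)
    simpa using this
  · intro a ha b hb e
    exact hf.2.1 (by simpa using ha) (by simpa using hb) e
  · intro b hb
    obtain ⟨a, ha, e⟩ := hf.2.2 (by simpa using hb : b ∈ Set.Icc 1 n)
    exact ⟨a, by simpa using ha, e⟩
  · intros; rfl

lemma ehr_last (n : ℕ) (hn : 4 ≤ n) (u w : ℕ → ℕ) (hu : IsPermOn n u) (hw : IsPermOn n w)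
    (h : Ehr n u w) : w n ≤ u n := by
  have h1 := (h (n-1) (by omega) (by omega)).sum_le_sum
  rw [piSort_sum, piSort_sum] at h1
  have h2 := (perm_sum n u hu).trans (perm_sum n w hw).symm
  obtain ⟨m, rfl⟩ : ∃ m, n = m + 1 := ⟨n - 1, by omega⟩
  rw [Finset.sum_Icc_succ_top (by omega), Finset.sum_Icc_succ_top (by omega)] at h2
  simp only [Nat.add_sub_cancel] at h1
  omega

lemma isPermOn_of (n : ℕ) (f : ℕ → ℕ) (h : Set.MapsTo f (Set.Icc 1 n) (Set.Icc 1 n))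
    (hi : Set.InjOn f (Set.Icc 1 n)) : IsPermOn n f :=
  ⟨h, hi, by
    have := Finset.surjOn_of_injOn_of_card_le (s := Finset.Icc 1 n) (t := Finset.Icc 1 n) f
      (by simpa using h) (by simpa using hi) le_rfl
    simpa using this⟩

lemma v0_perm (n i : ℕ) (hn : 4 ≤ n) (hi1 : 1 ≤ i) (hi2 : i ≤ n - 2) : IsPermOn n (v0 n i) := by
  apply isPermOn_of
  · intro a ha
    simp only [Set.mem_Icc, v0] at *
    split_ifs <;> omega
  · intro a ha b hb e
    simp only [Set.mem_Icc, v0] at *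
    split_ifs at e <;> omega

/-- the bottom permutation `(1,…,i+1,i+3,…,n,i+2)` -/
def chi0 (n i : ℕ) : ℕ → ℕ := fun k =>
  if k ≤ i + 1 then k else if k ≤ n - 1 then k + 1 else i + 2

lemma chi0_perm (n i : ℕ) (hn : 4 ≤ n) (hi1 : 1 ≤ i) (hi2 : i ≤ n - 2) :
    IsPermOn n (chi0 n i) := by
  apply isPermOn_of
  · intro a ha
    simp only [Set.mem_Icc, chi0] at *
    split_ifs <;> omega
  · intro a ha b hb e
    simp only [Set.mem_Icc, chi0] at *
    split_ifs at e <;> omega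

/-- sorted version of the first `k` values of `v0` -/
def sv (i k : ℕ) : ℕ → ℕ := fun j =>
  if j < min k (i + 1) then j else if j = min k (i + 1) then i + 2 else j + 1

lemma chi0_le (n i : ℕ) (hn : 4 ≤ n) (hi1 : 1 ≤ i) (hi2 : i ≤ n - 2) :
    Ehr n (chi0 n i) (v0 n i) := by
  intro k hk1 hkn
  have hc := chi0_perm n i hn hi1 hi2
  have hv := v0_perm n i hn hi1 hi2
  rcases Nat.lt_or_ge k n with hk | hk
  · have hs : piSort (v0 n i) k = piSort (sv i k) k := by
      apply piSort_congr
      · exact hv.2.1.mono (Set.Icc_subset_Icc le_rfl hkn)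
      · intro a ha b hb e
        simp only [Set.mem_Icc, sv] at *
        split_ifs at e <;> omega
      · ext a
        simp only [Set.mem_image, Set.mem_Icc]
        constructor
        · rintro ⟨x, hx, rfl⟩
          refine ⟨if x = 1 then min k (i+1) else if x ≤ i + 1 then x - 1 else x, ?_, ?_⟩
          · split_ifs <;> omega
          · unfold sv v0
            split_ifs <;> omega
        · rintro ⟨x, hx, rfl⟩
          refine ⟨if x = min k (i+1) then 1 else if x < min k (i + 1) then x + 1 else x, ?_, ?_⟩
          · split_ifs <;> omega
          · unfold sv v0
            split_ifs <;> omega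
    rw [hs, piSort_mono, piSort_mono, List.forall₂_map_left_iff, List.forall₂_map_right_iff,
      List.forall₂_same]
    · intro x hx
      rw [List.mem_range'_1] at hx
      unfold sv chi0
      split_ifs <;> omega
    · intro a ha b hb hab
      simp only [Set.mem_Icc, sv] at *
      split_ifs <;> omega
    · intro a ha b hb hab
      simp only [Set.mem_Icc, chi0] at *
      split_ifs <;> omega
  · obtain rfl : k = n := by omega
    rw [piSort_congr _ _ k hc.2.1 hv.2.1 (hc.image_eq.trans hv.image_eq.symm)]
    exact List.forall₂_same.2 fun _ _ => le_rfl

theorem stmt6 (n i : ℕ) (hn : 4 ≤ n) (hi1 : 1 ≤ i) (hi2 : i ≤ n - 2)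
    (l : ℕ) (hl : l ∈ Set.Icc 1 n) :
    Admissible n (v0 n i) l ↔ l = i + 2 := by
  have hv := v0_perm n i hn hi1 hi2
  constructor
  · rintro ⟨φ, χ, hφ, hχ, h1, h2, e1, e2⟩
    have a1 := ehr_last n hn _ _ hχ hφ h1
    have a2 := ehr_last n hn _ _ hφ hv h2
    have a3 : φ 1 ≤ v0 n i 1 := by
      have := h2 1 le_rfl (by omega)
      simpa [piSort] using this
    have a4 : φ 1 ≠ φ n := by
      intro e
      have := hφ.2.1 ⟨le_rfl, by omega⟩ ⟨by omega, le_rfl⟩ e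
      omega
    have b1 : v0 n i 1 = i + 2 := by simp [v0]
    have b2 : v0 n i n = i + 1 := by
      unfold v0
      split_ifs <;> omega
    omega
  · rintro rfl
    refine ⟨v0 n i, chi0 n i, hv, chi0_perm n i hn hi1 hi2, chi0_le n i hn hi1 hi2, ?_, ?_, ?_⟩
    · intro k _ _
      exact List.forall₂_same.2 fun _ _ => le_rfl
    · simp [v0]
    · unfold chi0
      split_ifs <;> omega
end

section
/- For n ≥ 4, 1 ≤ i ≤ n−2 and 2 ≤ j ≤ n−2, let w ∈ S_n be defined by w(1) = i+2, w(m) = v_{0,i}(m+1) for 2 ≤ m ≤ j, w(j+1) = 1, and w(m) = v_{0,i}(m) for j+2 ≤ m ≤ n. Then w is a permutation and the set of w-admissible integers is exactly {i+2}; in particular it has exactly one element. (This is the combinatorial content of the paper's Lemma that dim H^0(X(v_{1,j}), L_{α_0})^T = 1 for these one-step extensions of the minimal element v_{0,i}.) -/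
/-- The one-step extension `v_{1,j}` of `v_{0,i}`:
`w(1) = i+2`, `w(m) = v_{0,i}(m+1)` for `2 ≤ m ≤ j`, `w(j+1) = 1`,
and `w(m) = v_{0,i}(m)` for `m ≥ j+2`. -/
def w1 (n i j : ℕ) : ℕ → ℕ := fun m =>
  if m = 1 then i + 2
  else if m ≤ j then v0 n i (m + 1)
  else if m = j + 1 then 1
  else v0 n i m

theorem aux_perm_of_injOn (n : ℕ) (f : ℕ → ℕ)
    (hm : ∀ a, 1 ≤ a → a ≤ n → 1 ≤ f a ∧ f a ≤ n)
    (hinj : ∀ a b, 1 ≤ a → a ≤ n → 1 ≤ b → b ≤ n → f a = f b → a = b) : IsPermOn n f := by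
  have h1 : Set.MapsTo f (Finset.Icc 1 n : Finset ℕ) (Finset.Icc 1 n : Finset ℕ) := by
    intro a ha
    simp only [Finset.coe_Icc, Set.mem_Icc] at ha ⊢
    exact hm a ha.1 ha.2
  have h2 : Set.InjOn f (Finset.Icc 1 n : Finset ℕ) := by
    intro a ha b hb h
    simp only [Finset.coe_Icc, Set.mem_Icc] at ha hb
    exact hinj a b ha.1 ha.2 hb.1 hb.2 h
  have h3 := Finset.surjOn_of_injOn_of_card_le f h1 h2 le_rfl
  unfold IsPermOn
  rw [← Finset.coe_Icc]
  exact ⟨h1, h2, h3⟩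

theorem aux_list_perm (n : ℕ) (f : ℕ → ℕ) (h : IsPermOn n f) :
    ((List.range' 1 n).map f).Perm (List.range' 1 n) := by
  have hmem : ∀ a, a ∈ List.range' 1 n ↔ a ∈ Set.Icc 1 n := by
    intro a
    rw [List.mem_range'_1, Set.mem_Icc]
    omega
  rw [List.perm_ext_iff_of_nodup]
  · intro a
    rw [List.mem_map, hmem, ← h.image_eq]
    simp only [hmem, Set.mem_image]
  · apply List.Nodup.map_on _ List.nodup_range'
    intro x hx y hy hxy
    exact h.injOn ((hmem x).1 hx) ((hmem y).1 hy) hxy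
  · exact List.nodup_range'

theorem aux_last (n : ℕ) (hn : 2 ≤ n) (u w : ℕ → ℕ) (hu : IsPermOn n u) (hw : IsPermOn n w)
    (h : Ehr n u w) : w n ≤ u n := by
  have h1 := (h (n - 1) (by omega) (by omega)).sum_le_sum
  unfold piSort at h1
  rw [(List.perm_insertionSort _ _).sum_eq, (List.perm_insertionSort _ _).sum_eq] at h1
  have h2 := (aux_list_perm n u hu).sum_eq
  have h3 := (aux_list_perm n w hw).sum_eq
  obtain ⟨m, rfl⟩ : ∃ m, n = m + 1 := ⟨n - 1, by omega⟩
  rw [← h3, List.range'_1_concat] at h2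
  simp only [List.map_append, List.sum_append, List.map_cons, List.map_nil, List.sum_cons,
    List.sum_nil, Nat.add_sub_cancel, Nat.add_comm 1 m] at h1 h2
  omega

theorem aux_insert (l l' : List ℕ) (h : List.Forall₂ (· ≤ ·) l l') :
    ∀ a b : ℕ, a ≤ b → l.Pairwise (· ≤ ·) → l'.Pairwise (· ≤ ·) →
    List.Forall₂ (· ≤ ·) (l.orderedInsert (· ≤ ·) a) (l'.orderedInsert (· ≤ ·) b) := by
  induction h with
  | nil => intro a b hab _ _; simpa using hab
  | @cons x y l l' hxy hl ih =>
    intro a b hab s s'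
    have t := List.pairwise_cons.1 s
    have t' := List.pairwise_cons.1 s'
    have e : ∀ (z : ℕ) (L : List ℕ), (∀ c ∈ L, z ≤ c) →
        L.orderedInsert (· ≤ ·) z = z :: L := by
      intro z L hL
      cases L with
      | nil => rfl
      | cons c L => rw [List.orderedInsert, if_pos (hL c (by simp))]
    rw [List.orderedInsert, List.orderedInsert]
    split_ifs with h1 h2 h2
    · exact .cons hab (.cons hxy hl)
    · refine .cons (by omega) ?_
      rw [← e x l t.1]
      exact ih x b (by omega) t.2 t'.2
    · refine .cons (by omega) ?_
      rw [← e y l' t'.1]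
      exact ih a y (by omega) t.2 t'.2
    · exact .cons hxy (ih a b hab t.2 t'.2)

theorem aux_sort (l l' : List ℕ) (h : List.Forall₂ (· ≤ ·) l l') :
    List.Forall₂ (· ≤ ·) (l.insertionSort (· ≤ ·)) (l'.insertionSort (· ≤ ·)) := by
  induction h with
  | nil => simp
  | @cons x y l l' hxy hl ih =>
    exact aux_insert _ _ ih x y hxy (List.pairwise_insertionSort _ _)
      (List.pairwise_insertionSort _ _)

theorem aux_ehr (n : ℕ) (u w : ℕ → ℕ) (hu : IsPermOn n u) (hw : IsPermOn n w)
    (h : ∀ m, 1 ≤ m → m < n → u m ≤ w m) : Ehr n u w := by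
  intro k hk hkn
  rcases Nat.lt_or_ge k n with hlt | hge
  · apply aux_sort
    rw [List.forall₂_map_left_iff, List.forall₂_map_right_iff, List.forall₂_same]
    intro x hx
    rw [List.mem_range'_1] at hx
    exact h x (by omega) (by omega)
  · obtain rfl : k = n := by omega
    have hp := (aux_list_perm k u hu).trans (aux_list_perm k w hw).symm
    have : piSort u k = piSort w k := by
      unfold piSort
      exact (((List.perm_insertionSort _ _).trans hp).trans
        (List.perm_insertionSort _ _).symm).eq_of_pairwise
          (fun a b _ _ h1 h2 => le_antisymm h1 h2)
          (List.pairwise_insertionSort _ _) (List.pairwise_insertionSort _ _)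
    rw [this, List.forall₂_same]
    exact fun _ _ => le_rfl

theorem aux_w_perm (n i j : ℕ) (hn : 4 ≤ n) (hi1 : 1 ≤ i) (hi2 : i ≤ n - 2)
    (hj1 : 2 ≤ j) (hj2 : j ≤ n - 2) : IsPermOn n (w1 n i j) := by
  have hc : ∀ a, 1 ≤ a → a ≤ n →
      (a = 1 ∧ w1 n i j a = i + 2) ∨ (2 ≤ a ∧ a ≤ j ∧ a ≤ i ∧ w1 n i j a = a) ∨
      (2 ≤ a ∧ a ≤ j ∧ i < a ∧ w1 n i j a = a + 2) ∨ (a = j + 1 ∧ w1 n i j a = 1) ∨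
      (j + 2 ≤ a ∧ a ≤ i + 1 ∧ w1 n i j a + 1 = a) ∨
      (j + 2 ≤ a ∧ i + 2 ≤ a ∧ a < n ∧ w1 n i j a = a + 1) ∨ (a = n ∧ w1 n i j a = i + 1) := by
    intro a h1 h2
    unfold w1 v0
    split_ifs <;> omega
  apply aux_perm_of_injOn
  · intro a h1 h2
    rcases hc a h1 h2 with h | h | h | h | h | h | h <;> omega
  · intro a b h1 h2 h3 h4 h
    rcases hc a h1 h2 with h | h | h | h | h | h | h <;>
      rcases hc b h3 h4 with h' | h' | h' | h' | h' | h' | h' <;> omega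

theorem stmt8 (n i j : ℕ) (hn : 4 ≤ n) (hi1 : 1 ≤ i) (hi2 : i ≤ n - 2)
    (hj1 : 2 ≤ j) (hj2 : j ≤ n - 2) :
    IsPermOn n (w1 n i j) ∧
    {l : ℕ | Admissible n (w1 n i j) l} = {i + 2} ∧
    {l : ℕ | Admissible n (w1 n i j) l}.ncard = 1 := by
  have hw := aux_w_perm n i j hn hi1 hi2 hj1 hj2
  have w_one : w1 n i j 1 = i + 2 := by simp [w1]
  have w_n : w1 n i j n = i + 1 := by
    unfold w1 v0
    split_ifs <;> omega
  have key : {l : ℕ | Admissible n (w1 n i j) l} = {i + 2} := by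
    ext l
    simp only [Set.mem_ofPred_eq, Set.mem_singleton_iff]
    constructor
    · rintro ⟨φ, χ, hφ, hχ, h1, h2, h3, h4⟩
      have a1 := aux_last n (by omega) _ _ hχ hφ h1
      have a2 := aux_last n (by omega) _ _ hφ hw h2
      have a3 : φ 1 ≤ i + 2 := by
        have := h2 1 le_rfl (by omega)
        simpa [piSort, w_one] using this
      have a4 : φ 1 ≠ φ n := by
        intro h
        have := hφ.injOn (Set.mem_Icc.2 ⟨le_rfl, by omega⟩)
          (Set.mem_Icc.2 ⟨by omega, le_rfl⟩) h
        omega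
      omega
    · rintro rfl
      have inj : ∀ a b, 1 ≤ a → a ≤ n → 1 ≤ b → b ≤ n → w1 n i j a = w1 n i j b → a = b :=
        fun a b p q r s t => hw.injOn ⟨p, q⟩ ⟨r, s⟩ t
      have hχ : IsPermOn n (fun m => if m = 1 then i + 1 else if m = n then i + 2
          else w1 n i j m) := by
        apply aux_perm_of_injOn
        · intro a p q
          have := hw.mapsTo (Set.mem_Icc.2 ⟨p, q⟩)
          rw [Set.mem_Icc] at this
          split_ifs <;> omega
        · intro a b p q r s t
          have k1 := inj a 1 p q le_rfl (by omega)
          have k2 := inj b 1 r s le_rfl (by omega)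
          have k3 := inj a n p q (by omega) le_rfl
          have k4 := inj b n r s (by omega) le_rfl
          have k5 := inj a b p q r s
          split_ifs at t <;> omega
      refine ⟨w1 n i j, _, hw, hχ, aux_ehr n _ _ hχ hw ?_, aux_ehr n _ _ hw hw ?_, w_one, ?_⟩
      · intro m p q
        split_ifs with c1 c2
        · subst c1; omega
        · omega
        · exact le_rfl
      · exact fun _ _ _ => le_rfl
      · rw [if_neg (by omega), if_pos rfl]
  refine ⟨hw, key, ?_⟩
  rw [key, Set.ncard_singleton]
end

section
/- For n ≥ 4 and 1 ≤ i ≤ n−2, let w ∈ S_n have one-line notation (i+2, 2, 3, ..., i, i+3, i+4, ..., n, i+1, 1), i.e. w(1) = i+2, w(m) = m for 2 ≤ m ≤ i, w(m) = m+2 for i+1 ≤ m ≤ n−2, w(n−1) = i+1, and w(n) = 1. Then the set of w-admissible integers is exactly {2, 3, ..., i+2}; in particular it has i+1 elements. (This is the combinatorial content of the paper's Lemma that dim H^0(X(w), L_{α_0})^T = i+1 for the extension w = v_{1,n−1} of the minimal element v_{0,i}; the case i = n−2 recovers the count n−1 of the paper's Lemma 5.12(2).) -/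
/-- The permutation with one-line notation `(i+2, 2, 3, ..., i, i+3, i+4, ..., n, i+1, 1)`. -/
def w2 (n i : ℕ) : ℕ → ℕ := fun m =>
  if m = 1 then i + 2
  else if m ≤ i then m
  else if m ≤ n - 2 then m + 2
  else if m = n - 1 then i + 1
  else if m = n then 1
  else m

/-- If `g` is strictly increasing on `1..k` and lists the values of `f`, then it computes `piSort`. -/
lemma piSort_eq (f g : ℕ → ℕ) (k : ℕ)
    (hf : ∀ a b, 1 ≤ a → a ≤ k → 1 ≤ b → b ≤ k → f a = f b → a = b)
    (hg : ∀ a b, 1 ≤ a → a < b → b ≤ k → g a < g b)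
    (hfg : ∀ m, 1 ≤ m → m ≤ k → ∃ j, 1 ≤ j ∧ j ≤ k ∧ g j = f m) :
    piSort f k = (List.range' 1 k).map g := by
  have hsort : ((List.range' 1 k).map g).Pairwise (· ≤ ·) := by
    rw [List.pairwise_map]
    refine List.Pairwise.imp_of_mem ?_ (List.pairwise_lt_range' (s := 1) (n := k))
    intro a b ha hb hab
    rw [List.mem_range'_1] at ha hb
    exact (hg a b (by omega) hab (by omega)).le
  have hnd : ((List.range' 1 k).map f).Nodup := by
    refine List.Nodup.map_on ?_ (List.nodup_range' (s := 1) (n := k))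
    intro a ha b hb hab
    rw [List.mem_range'_1] at ha hb
    exact hf a b (by omega) (by omega) (by omega) (by omega) hab
  have hperm : ((List.range' 1 k).map f).Perm ((List.range' 1 k).map g) := by
    refine (List.subperm_of_subset hnd ?_).perm_of_length_le (by simp)
    intro x hx
    rw [List.mem_map] at hx ⊢
    obtain ⟨m, hm, rfl⟩ := hx
    rw [List.mem_range'_1] at hm
    obtain ⟨j, h1, h2, h3⟩ := hfg m (by omega) (by omega)
    exact ⟨j, by rw [List.mem_range'_1]; omega, h3⟩
  unfold piSort
  exact List.Perm.eq_of_pairwise' (List.pairwise_insertionSort _ _) hsort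
    ((List.perm_insertionSort _ _).trans hperm)

lemma forall_map (g h : ℕ → ℕ) (k : ℕ) (H : ∀ j, 1 ≤ j → j ≤ k → g j ≤ h j) :
    List.Forall₂ (· ≤ ·) ((List.range' 1 k).map g) ((List.range' 1 k).map h) := by
  rw [List.forall₂_map_left_iff, List.forall₂_map_right_iff, List.forall₂_same]
  intro j hj
  rw [List.mem_range'_1] at hj
  exact H j (by omega) (by omega)

lemma isPermOn_of_s9 (n : ℕ) (f : ℕ → ℕ) (hm : ∀ a, 1 ≤ a → a ≤ n → 1 ≤ f a ∧ f a ≤ n)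
    (hf : ∀ a b, 1 ≤ a → a ≤ n → 1 ≤ b → b ≤ n → f a = f b → a = b) : IsPermOn n f := by
  have hmt : Set.MapsTo f (Set.Icc 1 n) (Set.Icc 1 n) := fun a ha => hm a ha.1 ha.2
  exact ((Set.finite_Icc 1 n).injOn_iff_bijOn_of_mapsTo hmt).1
    (fun a ha b hb h => hf a b ha.1 ha.2 hb.1 hb.2 h)

/-- One-line notation `(l, 1, ..., l-2, l+1, ..., n, l-1)`. -/
def phiW (n l : ℕ) : ℕ → ℕ := fun m =>
  if m = 1 then l else if m ≤ l - 1 then m - 1 else if m < n then m + 1 else l - 1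

/-- One-line notation `(1, ..., l-1, l+1, ..., n, l)`. -/
def chiW (n l : ℕ) : ℕ → ℕ := fun m =>
  if m < l then m else if m < n then m + 1 else l

/-- Sorted values of `phiW`. -/
def phiS (n l k : ℕ) : ℕ → ℕ := fun j =>
  if k = n then j else if j < k ∧ j ≤ l - 2 then j else if k ≤ l - 1 then l else j + 1

/-- Sorted values of `chiW`. -/
def chiS (n l k : ℕ) : ℕ → ℕ := fun j =>
  if k = n then j else if j < l then j else j + 1

/-- Sorted values of `w2`. -/
def wS (n i k : ℕ) : ℕ → ℕ := fun j =>
  if k = n then j else if k = n - 1 then j + 1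
  else if k ≤ i then (if j < k then j + 1 else i + 2)
  else if j < i then j + 1 else j + 2

lemma phiW_inj (n l : ℕ) (h2 : 2 ≤ l) (hl : l ≤ n) (a b : ℕ) (ha : 1 ≤ a) (ha' : a ≤ n)
    (hb : 1 ≤ b) (hb' : b ≤ n) (h : phiW n l a = phiW n l b) : a = b := by
  unfold phiW at h
  split_ifs at h <;> omega

lemma chiW_inj (n l : ℕ) (h2 : 2 ≤ l) (hl : l ≤ n) (a b : ℕ) (ha : 1 ≤ a) (ha' : a ≤ n)
    (hb : 1 ≤ b) (hb' : b ≤ n) (h : chiW n l a = chiW n l b) : a = b := by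
  unfold chiW at h
  split_ifs at h <;> omega

lemma w2_inj (n i : ℕ) (hn : 4 ≤ n) (hi1 : 1 ≤ i) (hi2 : i ≤ n - 2) (a b : ℕ)
    (ha : 1 ≤ a) (ha' : a ≤ n)
    (hb : 1 ≤ b) (hb' : b ≤ n) (h : w2 n i a = w2 n i b) : a = b := by
  unfold w2 at h
  split_ifs at h <;> omega

lemma piSort_phi (n l k : ℕ) (h2 : 2 ≤ l) (hl : l ≤ n) (hk : k ≤ n) :
    piSort (phiW n l) k = (List.range' 1 k).map (phiS n l k) := by
  apply piSort_eq
  · intro a b h1 h3 h4 h5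
    exact phiW_inj n l h2 hl a b h1 (by omega) h4 (by omega)
  · intro a b h1 h3 h4
    unfold phiS
    split_ifs <;> omega
  · intro m h1 h3
    by_cases hkn : k = n
    · refine ⟨phiW n l m, ?_, ?_, by simp [phiS, hkn]⟩ <;> unfold phiW <;> split_ifs <;> omega
    · refine ⟨if m = 1 then min k (l - 1) else if m ≤ l - 1 then m - 1 else m, ?_, ?_, ?_⟩
      · split_ifs <;> omega
      · split_ifs <;> omega
      · unfold phiS phiW
        split_ifs <;> omega

lemma piSort_chi (n l k : ℕ) (h2 : 2 ≤ l) (hl : l ≤ n) (hk : k ≤ n) :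
    piSort (chiW n l) k = (List.range' 1 k).map (chiS n l k) := by
  apply piSort_eq
  · intro a b h1 h3 h4 h5
    exact chiW_inj n l h2 hl a b h1 (by omega) h4 (by omega)
  · intro a b h1 h3 h4
    unfold chiS
    split_ifs <;> omega
  · intro m h1 h3
    by_cases hkn : k = n
    · refine ⟨chiW n l m, ?_, ?_, by simp [chiS, hkn]⟩ <;> unfold chiW <;> split_ifs <;> omega
    · refine ⟨m, h1, h3, ?_⟩
      unfold chiS chiW
      split_ifs <;> omega

lemma piSort_w2 (n i k : ℕ) (hn : 4 ≤ n) (hi1 : 1 ≤ i) (hi2 : i ≤ n - 2) (hk : k ≤ n) :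
    piSort (w2 n i) k = (List.range' 1 k).map (wS n i k) := by
  apply piSort_eq
  · intro a b h1 h3 h4 h5
    exact w2_inj n i hn hi1 hi2 a b h1 (by omega) h4 (by omega)
  · intro a b h1 h3 h4
    unfold wS
    split_ifs <;> omega
  · intro m h1 h3
    by_cases hkn : k = n
    · refine ⟨w2 n i m, ?_, ?_, by simp [wS, hkn]⟩ <;> unfold w2 <;> split_ifs <;> omega
    · by_cases hkn1 : k = n - 1
      · refine ⟨w2 n i m - 1, ?_, ?_, ?_⟩
        · unfold w2
          split_ifs <;> omega
        · unfold w2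
          split_ifs <;> omega
        · unfold wS w2
          split_ifs <;> omega
      · refine ⟨if m = 1 then min k i else if m ≤ i then m - 1 else m, ?_, ?_, ?_⟩
        · split_ifs <;> omega
        · split_ifs <;> omega
        · unfold wS w2
          split_ifs <;> omega

lemma admissible_iff (n i : ℕ) (hn : 4 ≤ n) (hi1 : 1 ≤ i) (hi2 : i ≤ n - 2) (l : ℕ) :
    Admissible n (w2 n i) l ↔ 2 ≤ l ∧ l ≤ i + 2 := by
  constructor
  · rintro ⟨φ, χ, hφ, hχ, h1, h2, h3, h4⟩
    have hup : l ≤ i + 2 := by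
      have := h2 1 le_rfl (by omega)
      simpa [piSort, w2, h3] using this
    have hl1 : 1 ≤ l := h3 ▸ (hφ.mapsTo (show 1 ∈ Set.Icc 1 n from ⟨le_rfl, by omega⟩)).1
    refine ⟨?_, hup⟩
    by_contra hlt
    have hl : l = 1 := by omega
    have hF := h1 (n - 1) (by omega) (by omega)
    have hmem : φ 1 ∈ piSort φ (n - 1) := by
      unfold piSort
      rw [List.mem_insertionSort, List.mem_map]
      exact ⟨1, by rw [List.mem_range'_1]; omega, rfl⟩
    obtain ⟨p, hp, hpe⟩ := List.mem_iff_getElem.1 hmem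
    have hlen := hF.length_eq
    have hle := (List.forall₂_iff_get.1 hF).2 p (by omega) hp
    have hmem2 : (piSort χ (n - 1))[p]'(by omega) ∈ piSort χ (n - 1) := List.getElem_mem _
    simp only [List.get_eq_getElem] at hle
    rw [hpe] at hle
    generalize (piSort χ (n - 1))[p]'(by omega) = x at hle hmem2
    unfold piSort at hmem2
    rw [List.mem_insertionSort, List.mem_map] at hmem2
    obtain ⟨m, hm, rfl⟩ := hmem2
    rw [List.mem_range'_1] at hm
    have hmI : m ∈ Set.Icc 1 n := ⟨by omega, by omega⟩
    have hx := (hχ.mapsTo hmI).1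
    have := hχ.injOn hmI (show n ∈ Set.Icc 1 n from ⟨by omega, le_rfl⟩) (by omega)
    omega
  · rintro ⟨h2, hl⟩
    have hln : l ≤ n := by omega
    refine ⟨phiW n l, chiW n l, ?_, ?_, ?_, ?_, ?_, ?_⟩
    · refine isPermOn_of_s9 _ _ ?_ (phiW_inj n l h2 hln)
      intro a h1 h3
      unfold phiW
      split_ifs <;> omega
    · refine isPermOn_of_s9 _ _ ?_ (chiW_inj n l h2 hln)
      intro a h1 h3
      unfold chiW
      split_ifs <;> omega
    · intro k hk1 hk
      rw [piSort_phi n l k h2 hln hk, piSort_chi n l k h2 hln hk]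
      apply forall_map
      intro j hj1 hj2
      unfold chiS phiS
      split_ifs <;> omega
    · intro k hk1 hk
      rw [piSort_phi n l k h2 hln hk, piSort_w2 n i k hn hi1 hi2 hk]
      apply forall_map
      intro j hj1 hj2
      unfold wS phiS
      split_ifs <;> omega
    · simp [phiW]
    · unfold chiW
      split_ifs <;> omega

theorem stmt9 (n i : ℕ) (hn : 4 ≤ n) (hi1 : 1 ≤ i) (hi2 : i ≤ n - 2) :
    {l : ℕ | Admissible n (w2 n i) l} = Set.Icc 2 (i + 2) ∧
    {l : ℕ | Admissible n (w2 n i) l}.ncard = i + 1 := by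
  have h : {l : ℕ | Admissible n (w2 n i) l} = Set.Icc 2 (i + 2) := by
    ext l
    exact admissible_iff n i hn hi1 hi2 l
  refine ⟨h, ?_⟩
  rw [h, ← Finset.coe_Icc, Set.ncard_coe_finset, Nat.card_Icc]
  omega
end

section
/- For n ≥ 2, let w_0 ∈ S_n be the longest element, with one-line notation (n, n−1, ..., 2, 1). Then the set of w_0-admissible integers is exactly {2, 3, ..., n}; in particular it has n−1 elements. (This is the combinatorial content of the paper's computation that dim H^0(SL(n,ℂ)/B, L_{α_0})^T = n−1, so that the torus quotient of the full flag variety with respect to L_{α_0} is a projective space of dimension n−2.) -/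
/-- The longest element `w_0` of `S_n`, with one-line notation `(n, n-1, ..., 2, 1)`. -/
def wLong (n : ℕ) : ℕ → ℕ := fun m =>
  if 1 ≤ m ∧ m ≤ n then n + 1 - m else m

theorem forall2_of_countP (l : List ℕ) : ∀ l' : List ℕ, l.length = l'.length →
    l.Pairwise (· ≤ ·) → l'.Pairwise (· ≤ ·) →
    (∀ t, l'.countP (fun x => decide (x ≤ t)) ≤ l.countP (fun x => decide (x ≤ t))) →
    List.Forall₂ (· ≤ ·) l l' := by
  induction l with
  | nil =>
    intro l' h _ _ _
    cases l' with
    | nil => exact List.Forall₂.nil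
    | cons b l' => simp at h
  | cons a l ih =>
    intro l' h hs hs' hc
    cases l' with
    | nil => simp at h
    | cons b l' =>
      rw [List.pairwise_cons] at hs hs'
      have hab : a ≤ b := by
        have h1 := hc b
        have h2 : 0 < (a :: l).countP (fun x => decide (x ≤ b)) := by
          refine lt_of_lt_of_le ?_ h1
          rw [List.countP_pos_iff]
          exact ⟨b, by simp, by simp⟩
        rw [List.countP_pos_iff] at h2
        obtain ⟨x, hx, hxb⟩ := h2
        have hxb' : x ≤ b := by simpa using hxb
        rcases List.mem_cons.1 hx with rfl | hx
        · exact hxb'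
        · exact (hs.1 x hx).trans hxb'
      refine List.Forall₂.cons hab (ih l' (by simpa using h) hs.2 hs'.2 ?_)
      intro t
      by_cases htb : b ≤ t
      · have h1 := hc t
        have hat : a ≤ t := hab.trans htb
        simpa [List.countP_cons, htb, hat] using h1
      · have h0 : l'.countP (fun x => decide (x ≤ t)) = 0 := by
          rw [List.countP_eq_zero]
          intro x hx
          have := hs'.1 x hx
          simp
          omega
        omega

/-- number of `i ∈ {1,…,k}` with `f i ≤ t`. -/
def cnt (f : ℕ → ℕ) (t k : ℕ) : ℕ :=
  ((List.range' 1 k).map f).countP (fun x => decide (x ≤ t))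

theorem cnt_zero (f : ℕ → ℕ) (t : ℕ) : cnt f t 0 = 0 := by simp [cnt]

theorem cnt_succ (f : ℕ → ℕ) (t k : ℕ) :
    cnt f t (k + 1) = cnt f t k + if f (k + 1) ≤ t then 1 else 0 := by
  unfold cnt
  rw [List.range'_1_concat, List.map_append, List.countP_append]
  simp [List.countP_cons, add_comm]

theorem ehr_of_cnt (n : ℕ) (u w : ℕ → ℕ)
    (h : ∀ k, 1 ≤ k → k ≤ n → ∀ t, cnt w t k ≤ cnt u t k) : Ehr n u w := by
  intro k h1 h2
  refine forall2_of_countP _ _ ?_ ?_ ?_ ?_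
  · simp [piSort]
  · exact List.pairwise_insertionSort _ _
  · exact List.pairwise_insertionSort _ _
  · intro t
    unfold piSort
    rw [(List.perm_insertionSort _ _).countP_eq, (List.perm_insertionSort _ _).countP_eq]
    exact h k h1 h2 t

def phiF (n l : ℕ) : ℕ → ℕ := fun i => if i ≤ n + 1 - l then l + i - 1 else i - (n + 1 - l)

def chiF (n l : ℕ) : ℕ → ℕ := fun i => if i < l then i else if i < n then i + 1 else l

theorem isPermOn_of_inv (n : ℕ) (f g : ℕ → ℕ)
    (h : ∀ i, 1 ≤ i → i ≤ n → 1 ≤ f i ∧ f i ≤ n ∧ g (f i) = i)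
    (h' : ∀ i, 1 ≤ i → i ≤ n → 1 ≤ g i ∧ g i ≤ n ∧ f (g i) = i) : IsPermOn n f := by
  refine Set.InvOn.bijOn (f' := g) ⟨?_, ?_⟩ ?_ ?_
  · intro i hi; exact (h i hi.1 hi.2).2.2
  · intro i hi; exact (h' i hi.1 hi.2).2.2
  · intro i hi; exact ⟨(h i hi.1 hi.2).1, (h i hi.1 hi.2).2.1⟩
  · intro i hi; exact ⟨(h' i hi.1 hi.2).1, (h' i hi.1 hi.2).2.1⟩

theorem phi_perm (n l : ℕ) (h2 : 2 ≤ l) (hl : l ≤ n) : IsPermOn n (phiF n l) := by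
  refine isPermOn_of_inv n _ (fun i => if l ≤ i then i + 1 - l else i + (n + 1 - l)) ?_ ?_
  · intro i h1 h2
    simp only [phiF]
    split_ifs <;> omega
  · intro i h1 h2
    simp only [phiF]
    split_ifs <;> omega

theorem chi_perm (n l : ℕ) (h2 : 2 ≤ l) (hl : l ≤ n) : IsPermOn n (chiF n l) := by
  refine isPermOn_of_inv n _ (fun i => if i < l then i else if i = l then n else i - 1) ?_ ?_
  · intro i h1 h2
    simp only [chiF]
    split_ifs <;> omega
  · intro i h1 h2
    simp only [chiF]
    split_ifs <;> omega

theorem cnt_phi (n l t : ℕ) (h2 : 2 ≤ l) (hl : l ≤ n) (k : ℕ) (hk : k ≤ n) :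
    cnt (phiF n l) t k =
      min k (min (t + 1 - l) (n + 1 - l)) + min (k - (n + 1 - l)) t := by
  induction k with
  | zero => simp [cnt_zero]
  | succ k ih =>
    rw [cnt_succ, ih (by omega)]
    simp only [phiF]
    split_ifs <;> omega

theorem cnt_chi (n l t : ℕ) (h2 : 2 ≤ l) (hl : l ≤ n) (k : ℕ) (hk : k < n) :
    cnt (chiF n l) t k = min k (if t < l then t else t - 1) := by
  induction k with
  | zero => simp [cnt_zero]
  | succ k ih =>
    rw [cnt_succ, ih (by omega)]
    simp only [chiF]
    split_ifs <;> omega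

theorem cnt_long (n t : ℕ) (k : ℕ) (hk : k ≤ n) :
    cnt (wLong n) t k ≤ k + t - n := by
  induction k with
  | zero => simp [cnt_zero]
  | succ k ih =>
    have := ih (by omega)
    rw [cnt_succ]
    simp only [wLong]
    split_ifs <;> omega

theorem cnt_le (f : ℕ → ℕ) (t k : ℕ) : cnt f t k ≤ k := by
  unfold cnt
  exact List.countP_le_length.trans (by simp)

theorem adm_iff (n : ℕ) (hn : 2 ≤ n) :
    {l : ℕ | Admissible n (wLong n) l} = Set.Icc 2 n := by
  ext l
  constructor
  · rintro ⟨φ, χ, hφ, hχ, h1, -, rfl, h3⟩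
    have hm := hφ.mapsTo (show 1 ∈ Set.Icc 1 n from ⟨le_rfl, by omega⟩)
    refine ⟨?_, hm.2⟩
    by_contra hlt
    have hφ1 : φ 1 = 1 := by have := hm.1; omega
    have h4 := h1 1 le_rfl (by omega)
    simp [piSort] at h4
    have hm' := hχ.mapsTo (show 1 ∈ Set.Icc 1 n from ⟨le_rfl, by omega⟩)
    have h5 : χ 1 = χ n := by have := hm'.1; omega
    have := hχ.injOn (show 1 ∈ Set.Icc 1 n from ⟨le_rfl, by omega⟩)
      (show n ∈ Set.Icc 1 n from ⟨by omega, le_rfl⟩) h5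
    omega
  · rintro ⟨h2, hl⟩
    refine ⟨phiF n l, chiF n l, phi_perm n l h2 hl, chi_perm n l h2 hl, ?_, ?_, ?_, ?_⟩
    · apply ehr_of_cnt
      intro k hk1 hk t
      rw [cnt_phi n l t h2 hl k hk]
      rcases hk.lt_or_eq with hlt | rfl
      · rw [cnt_chi n l t h2 hl k hlt]
        split_ifs <;> omega
      · obtain ⟨m, rfl⟩ : ∃ m, k = m + 1 := ⟨k - 1, by omega⟩
        rw [cnt_succ, cnt_chi (m + 1) l t h2 hl m (by omega)]
        simp only [chiF]
        split_ifs <;> omega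
    · apply ehr_of_cnt
      intro k hk1 hk t
      rw [cnt_phi n l t h2 hl k hk]
      have h1 := cnt_long n t k hk
      have h3 := cnt_le (wLong n) t k
      omega
    · simp only [phiF]
      split_ifs <;> omega
    · simp only [chiF]
      split_ifs <;> omega

theorem stmt10 (n : ℕ) (hn : 2 ≤ n) :
    {l : ℕ | Admissible n (wLong n) l} = Set.Icc 2 n ∧
    {l : ℕ | Admissible n (wLong n) l}.ncard = n - 1 := by
  refine ⟨adm_iff n hn, ?_⟩
  rw [adm_iff n hn, ← Finset.coe_Icc, Set.ncard_coe_finset, Nat.card_Icc]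
  omega
end
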